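/- Let m ≥ 1 be an integer, β > 0, C₀ > 0, ℋ > 0, ḡ(t) := 1 + C₀ t^{−β/2}, and c₁ > 0. Define W(s) := ( s^{−ℋ}( ∫_1^s ℋ t^{ℋ−1} ḡ(t) dt + c₁ ) )^{1/m} for s ≥ 1. If ℋ ≠ β/2, then there exist C > 0 and s₁ ≥ 1 such that |W(s) − 1| ≤ C s^{−min{β/2, ℋ}} for all s ≥ s₁. If ℋ = β/2, then there exist C > 0 and s₁ > 1 such that |W(s) − 1| ≤ C s^{−ℋ} ln s for all s ≥ s₁. -/

import Mathlib

open scoped BigOperators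
open Filter MeasureTheory

noncomputable section

/-- The `j`-th elementary symmetric function of `lam ∈ ℝⁿ`. -/
def esym (n j : ℕ) (lam : Fin n → ℝ) : ℝ :=
  ∑ S ∈ Finset.powersetCard j (Finset.univ : Finset (Fin n)), ∏ i ∈ S, lam i

/-- `σ_{j;i}`: the `j`-th elementary symmetric function with the `i`-th variable set to `0`. -/
def esymRem (n j : ℕ) (lam : Fin n → ℝ) (i : Fin n) : ℝ :=
  esym n j (Function.update lam i 0)

/-- The increasingly ordered eigenvalue vector of a real symmetric matrix
(junk value `0` if the matrix is not symmetric). -/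
def eigs {n : ℕ} (M : Matrix (Fin n) (Fin n) ℝ) : Fin n → ℝ :=
  if h : M.IsHermitian then h.eigenvalues ∘ (Tuple.sort h.eigenvalues) else 0

/-- The Hessian matrix `D²u(x)` of `u : ℝⁿ → ℝ`. -/
def hessianMatrix {n : ℕ} (u : EuclideanSpace ℝ (Fin n) → ℝ) (x : EuclideanSpace ℝ (Fin n)) :
    Matrix (Fin n) (Fin n) ℝ :=
  fun i j =>
    fderiv ℝ (fun y => fderiv ℝ u y (EuclideanSpace.single j 1)) x (EuclideanSpace.single i 1)

/-- The quadratic form `½ xᵀ A x`. -/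
def quadForm {n : ℕ} (A : Matrix (Fin n) (Fin n) ℝ) (x : EuclideanSpace ℝ (Fin n)) : ℝ :=
  (1 / 2) * ∑ i, ∑ j, A i j * x i * x j

/-- The Gårding cone `Γ_k = {λ : σ_j(λ) > 0, 1 ≤ j ≤ k}`. -/
def GammaK (n k : ℕ) : Set (Fin n → ℝ) :=
  {lam | ∀ j, 1 ≤ j → j ≤ k → 0 < esym n j lam}

/-- The Hessian quotient operator `S_{k,l}(M) = σ_k(λ(M))/σ_l(λ(M))`. -/
def Skl (n k l : ℕ) (M : Matrix (Fin n) (Fin n) ℝ) : ℝ :=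
  esym n k (eigs M) / esym n l (eigs M)

/-- `H_k(A) = max_i σ_{k-1;i}(λ(A)) λ_i(A) / σ_k(λ(A))`. -/
def Hk (n k : ℕ) (A : Matrix (Fin n) (Fin n) ℝ) : ℝ :=
  ⨆ i : Fin n, esymRem n (k - 1) (eigs A) i * eigs A i / esym n k (eigs A)

/-- `ψ` is admissible on the open set `A` with respect to the cone `Γ`:
it is `C²` on `A` and `λ(D²ψ) ∈ Γ` there. -/
def Admissible {n : ℕ} (Γ : Set (Fin n → ℝ)) (A : Set (EuclideanSpace ℝ (Fin n)))
    (ψ : EuclideanSpace ℝ (Fin n) → ℝ) : Prop :=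
  ContDiffOn ℝ 2 ψ A ∧ ∀ x ∈ A, eigs (hessianMatrix ψ x) ∈ Γ

/-- Viscosity subsolution of `F(D²u) = g` on `Ω` (for `F` of the form `f(λ(D²u))`). -/
def ViscSubsolution {n : ℕ} (Γ : Set (Fin n → ℝ)) (F : Matrix (Fin n) (Fin n) ℝ → ℝ)
    (g : EuclideanSpace ℝ (Fin n) → ℝ) (Ω : Set (EuclideanSpace ℝ (Fin n)))
    (u : EuclideanSpace ℝ (Fin n) → ℝ) : Prop :=
  UpperSemicontinuousOn u Ω ∧
    ∀ Aset : Set (EuclideanSpace ℝ (Fin n)), Aset ⊆ Ω → IsOpen Aset →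
      ∀ ψ : EuclideanSpace ℝ (Fin n) → ℝ, Admissible Γ Aset ψ →
        ∀ x₀ ∈ Aset, IsLocalMaxOn (fun y => u y - ψ y) Aset x₀ →
          g x₀ ≤ F (hessianMatrix ψ x₀)

/-- Viscosity supersolution of `F(D²u) = g` on `Ω`. -/
def ViscSupersolution {n : ℕ} (Γ : Set (Fin n → ℝ)) (F : Matrix (Fin n) (Fin n) ℝ → ℝ)
    (g : EuclideanSpace ℝ (Fin n) → ℝ) (Ω : Set (EuclideanSpace ℝ (Fin n)))
    (u : EuclideanSpace ℝ (Fin n) → ℝ) : Prop :=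
  LowerSemicontinuousOn u Ω ∧
    ∀ Aset : Set (EuclideanSpace ℝ (Fin n)), Aset ⊆ Ω → IsOpen Aset →
      ∀ ψ : EuclideanSpace ℝ (Fin n) → ℝ, Admissible Γ Aset ψ →
        ∀ x₀ ∈ Aset, IsLocalMinOn (fun y => u y - ψ y) Aset x₀ →
          F (hessianMatrix ψ x₀) ≤ g x₀

end

/-- `ḡ(t) = 1 + C₀ t^{-β/2}`. -/
noncomputable def gbar (C₀ β t : ℝ) : ℝ := 1 + C₀ * t ^ (-β / 2)

/-- `W(s) = ( s^{-ℋ} ( ∫₁ˢ ℋ t^{ℋ-1} ḡ(t) dt + c₁ ) )^{1/m}`. -/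
noncomputable def Wsub (m : ℕ) (Hc C₀ β c₁ : ℝ) (s : ℝ) : ℝ :=
  (s ^ (-Hc) * ((∫ t in (1:ℝ)..s, Hc * t ^ (Hc - 1) * gbar C₀ β t) + c₁)) ^ ((1 : ℝ) / m)

theorem abs_rpow_sub_one_le {x p : ℝ} (hx : 0 ≤ x) (hp : 0 < p) (hp1 : p ≤ 1) :
    |x ^ p - 1| ≤ |x - 1| := by
  rcases le_total 1 x with h | h
  · have h1 : 1 ≤ x ^ p := Real.one_le_rpow h hp.le
    have h2 : x ^ p ≤ x := by
      simpa using Real.rpow_le_rpow_of_exponent_le h hp1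
    rw [abs_of_nonneg (by linarith), abs_of_nonneg (by linarith)]
    linarith
  · have h1 : x ^ p ≤ 1 := Real.rpow_le_one hx h hp.le
    have h2 : x ≤ x ^ p := Real.self_le_rpow_of_le_one hx h hp1
    rw [abs_of_nonpos (by linarith), abs_of_nonpos (by linarith)]
    linarith

theorem integral_gbar {β C₀ Hc s : ℝ} (hHc : 0 < Hc) (hs : 1 ≤ s) :
    ∫ t in (1:ℝ)..s, Hc * t ^ (Hc - 1) * gbar C₀ β t =
      s ^ Hc - 1 + C₀ * Hc * ∫ t in (1:ℝ)..s, t ^ (Hc - 1 - β / 2) := by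
  have h0 : (0 : ℝ) ∉ Set.uIcc 1 s := by
    rw [Set.uIcc_of_le hs]
    exact fun h => by linarith [h.1]
  have hi (r : ℝ) : IntervalIntegrable (fun t : ℝ => t ^ r) volume 1 s :=
    intervalIntegral.intervalIntegrable_rpow (Or.inr h0)
  have hcongr : ∫ t in (1:ℝ)..s, Hc * t ^ (Hc - 1) * gbar C₀ β t =
      ∫ t in (1:ℝ)..s, (Hc * t ^ (Hc - 1) + C₀ * Hc * t ^ (Hc - 1 - β / 2)) := by
    refine intervalIntegral.integral_congr fun t ht => ?_
    rw [Set.uIcc_of_le hs] at ht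
    have ht0 : 0 < t := by linarith [ht.1]
    have : t ^ (Hc - 1 - β / 2) = t ^ (Hc - 1) * t ^ (-β / 2) := by
      rw [← Real.rpow_add ht0]
      ring_nf
    simp only [gbar, this]
    ring
  rw [hcongr, intervalIntegral.integral_add ((hi _).const_mul _) ((hi _).const_mul _),
    intervalIntegral.integral_const_mul, intervalIntegral.integral_const_mul,
    integral_rpow (Or.inl (by linarith))]
  simp only [sub_add_cancel, Real.one_rpow]
  field_simp

theorem abs_Wsub_sub_one_le {m : ℕ} {β C₀ Hc c₁ s : ℝ} (hm : 1 ≤ m)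
    (hC₀ : 0 < C₀) (hHc : 0 < Hc) (hc₁ : 0 < c₁) (hs : 1 ≤ s) :
    |Wsub m Hc C₀ β c₁ s - 1| ≤
      |s ^ (-Hc) * (c₁ - 1 + C₀ * Hc * ∫ t in (1:ℝ)..s, t ^ (Hc - 1 - β / 2))| := by
  have hs0 : 0 < s := by linarith
  have hm' : (1 : ℝ) ≤ m := by exact_mod_cast hm
  have hI : 0 ≤ ∫ t in (1:ℝ)..s, t ^ (Hc - 1 - β / 2) :=
    intervalIntegral.integral_nonneg hs fun t ht =>
      Real.rpow_nonneg (by linarith [ht.1]) _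
  have h1 : 1 ≤ s ^ Hc := Real.one_le_rpow hs hHc.le
  have hinv : s ^ (-Hc) * s ^ Hc = 1 := by
    rw [← Real.rpow_add hs0]
    simp
  have hCI := mul_nonneg (mul_pos hC₀ hHc).le hI
  rw [Wsub, integral_gbar hHc hs]
  refine (abs_rpow_sub_one_le (mul_nonneg (Real.rpow_nonneg hs0.le _) (by linarith))
    (by positivity) (div_le_one_of_le₀ hm' (by linarith))).trans (le_of_eq ?_)
  congr 1
  linear_combination hinv

/-- **Asymptotics (2.9)–(2.10)**: `W(s) - 1 = O(s^{-min{β/2,ℋ}})` as `s → ∞` if `ℋ ≠ β/2`,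
and `W(s) - 1 = O(s^{-ℋ} ln s)` if `ℋ = β/2`. -/
theorem Wsub_asymptotics
    (m : ℕ) (hm : 1 ≤ m) (β C₀ Hc c₁ : ℝ)
    (hβ : 0 < β) (hC₀ : 0 < C₀) (hHc : 0 < Hc) (hc₁ : 0 < c₁) :
    (Hc ≠ β / 2 →
      ∃ C s₁ : ℝ, 0 < C ∧ 1 ≤ s₁ ∧ ∀ s : ℝ, s₁ ≤ s →
        |Wsub m Hc C₀ β c₁ s - 1| ≤ C * s ^ (-(min (β / 2) Hc))) ∧
    (Hc = β / 2 →
      ∃ C s₁ : ℝ, 0 < C ∧ 1 < s₁ ∧ ∀ s : ℝ, s₁ ≤ s →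
        |Wsub m Hc C₀ β c₁ s - 1| ≤ C * s ^ (-Hc) * Real.log s) := by
  constructor
  · intro hne
    have hd : Hc - β / 2 ≠ 0 := sub_ne_zero.2 hne
    set K := C₀ * Hc / |Hc - β / 2| with hK
    have hK0 : 0 < K := by positivity
    refine ⟨|c₁ - 1| + K + K, 1, by positivity, le_rfl, fun s hs => ?_⟩
    have hs0 : 0 < s := by linarith
    have h0 : (0 : ℝ) ∉ Set.uIcc 1 s := by
      rw [Set.uIcc_of_le hs]
      exact fun h => by linarith [h.1]
    refine (abs_Wsub_sub_one_le hm hC₀ hHc hc₁ hs).trans ?_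
    rw [integral_rpow (Or.inr ⟨fun h => hd (by linarith), h0⟩),
      show Hc - 1 - β / 2 + 1 = Hc - β / 2 by ring, Real.one_rpow]
    have hmul : s ^ (-Hc) * s ^ (Hc - β / 2) = s ^ (-(β / 2)) := by
      rw [← Real.rpow_add hs0]
      ring_nf
    have hsplit : s ^ (-Hc) *
        (c₁ - 1 + C₀ * Hc * ((s ^ (Hc - β / 2) - 1) / (Hc - β / 2))) =
        (c₁ - 1) * s ^ (-Hc) + C₀ * Hc / (Hc - β / 2) * s ^ (-(β / 2)) -
          C₀ * Hc / (Hc - β / 2) * s ^ (-Hc) := by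
      rw [← hmul]
      ring
    have hH : s ^ (-Hc) ≤ s ^ (-(min (β / 2) Hc)) :=
      Real.rpow_le_rpow_of_exponent_le hs (neg_le_neg (min_le_right _ _))
    have hB : s ^ (-(β / 2)) ≤ s ^ (-(min (β / 2) Hc)) :=
      Real.rpow_le_rpow_of_exponent_le hs (neg_le_neg (min_le_left _ _))
    have habs : |C₀ * Hc / (Hc - β / 2)| = K := by
      rw [abs_div, abs_of_pos (mul_pos hC₀ hHc)]
    rw [hsplit]
    calc _ ≤ |(c₁ - 1) * s ^ (-Hc)| + |C₀ * Hc / (Hc - β / 2) * s ^ (-(β / 2))| +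
          |C₀ * Hc / (Hc - β / 2) * s ^ (-Hc)| :=
          (abs_sub _ _).trans (by gcongr; exact abs_add_le _ _)
      _ = |c₁ - 1| * s ^ (-Hc) + K * s ^ (-(β / 2)) + K * s ^ (-Hc) := by
          rw [abs_mul, abs_mul, abs_mul, habs, abs_of_pos (Real.rpow_pos_of_pos hs0 (-Hc)),
            abs_of_pos (Real.rpow_pos_of_pos hs0 (-(β / 2)))]
      _ ≤ |c₁ - 1| * s ^ (-(min (β / 2) Hc)) + K * s ^ (-(min (β / 2) Hc)) +
          K * s ^ (-(min (β / 2) Hc)) := by gcongr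
      _ = _ := by ring
  · intro heq
    refine ⟨|c₁ - 1| + C₀ * Hc, Real.exp 1, by positivity,
      Real.one_lt_exp_iff.2 one_pos, fun s hs => ?_⟩
    have hs1 : 1 ≤ s := (Real.one_lt_exp_iff.2 one_pos).le.trans hs
    have hs0 : 0 < s := by linarith
    have hlog : 1 ≤ Real.log s := (Real.le_log_iff_exp_le hs0).2 hs
    have hI : ∫ t in (1:ℝ)..s, t ^ (Hc - 1 - β / 2) = Real.log s := by
      rw [← heq, show Hc - 1 - Hc = -1 by ring]
      simp only [Real.rpow_neg_one]
      rw [integral_inv_of_pos one_pos hs0, div_one]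
    refine (abs_Wsub_sub_one_le hm hC₀ hHc hc₁ hs1).trans ?_
    have hpos := Real.rpow_pos_of_pos hs0 (-Hc)
    rw [hI, abs_mul, abs_of_pos hpos]
    calc _ ≤ s ^ (-Hc) * (|c₁ - 1| * Real.log s + C₀ * Hc * Real.log s) := by
          gcongr
          refine (abs_add_le _ _).trans (add_le_add ?_ (abs_of_nonneg (by positivity)).le)
          exact le_mul_of_one_le_right (abs_nonneg _) hlog
      _ = _ := by ring
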